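/- Let G be the geometric graph in ℝ² with vertices (0,0) and (1,0) joined by a single edge, and H the geometric graph with vertices (0,1) and (1,1) joined by a single edge. If C_E > C_V, then GED(G,H) = 2·C_V, and no edit path P from G to H attains Cost(P) = 2·C_V; i.e. the infimum defining GED(G,H) is not achieved. -/

import Mathlib

open scoped Classical
noncomputable section

/-- Points of the ambient Euclidean space `ℝ^d`. -/
abbrev Pt (d : ℕ) := EuclideanSpace ℝ (Fin d)

/-- A combinatorial graph embedded in `ℝ^d`: a finite vertex set of points together with a
finite set of (oriented representatives of) straight-line edges, recorded as pairs of points. -/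
structure EGraph (d : ℕ) where
  verts : Finset (Pt d)
  edges : Finset (Pt d × Pt d)

/-- A geometric graph of `ℝ^d`: the straight-line segments realizing the edges intersect
(possibly) only at shared endpoints. -/
structure GeoGraph (d : ℕ) extends EGraph d where
  edge_fst_mem : ∀ e ∈ edges, e.1 ∈ verts
  edge_snd_mem : ∀ e ∈ edges, e.2 ∈ verts
  edge_ne : ∀ e ∈ edges, e.1 ≠ e.2
  segments_meet_at_endpoints : ∀ e ∈ edges, ∀ f ∈ edges, e ≠ f →
    ∀ p ∈ segment ℝ e.1 e.2 ∩ segment ℝ f.1 f.2,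
      (p = e.1 ∨ p = e.2) ∧ (p = f.1 ∨ p = f.2)

/-- `Vol G`: the total edge length of `G`. -/
def EGraph.vol {d : ℕ} (G : EGraph d) : ℝ := ∑ e ∈ G.edges, dist e.1 e.2

/-- The degree of a vertex `u`: the number of edges incident to `u`. -/
def EGraph.degree {d : ℕ} (G : EGraph d) (u : Pt d) : ℕ :=
  (G.edges.filter (fun e => e.1 = u ∨ e.2 = u)).card

/-- The maximum vertex degree of a graph. -/
def EGraph.maxDegree {d : ℕ} (G : EGraph d) : ℕ := G.verts.sup G.degree

/-- A graph has no isolated vertex when every vertex has an incident edge. -/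
def NoIsolated {d : ℕ} (G : EGraph d) : Prop :=
  ∀ u ∈ G.verts, ∃ e ∈ G.edges, e.1 = u ∨ e.2 = u

/-- A state during an editing process: an abstract (labelled) combinatorial graph together
with an embedding of its vertices into `ℝ^d`.  Intermediate states need not be geometric
graphs (positions may even coincide). -/
structure EState (d : ℕ) where
  verts : Finset ℕ
  pos : ℕ → Pt d
  edges : Finset (ℕ × ℕ)

/-- A state represents a geometric graph when its embedded image is exactly that graph. -/
def EState.Represents {d : ℕ} (S : EState d) (G : EGraph d) : Prop :=
  Set.InjOn S.pos ↑S.verts ∧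
  S.verts.image S.pos = G.verts ∧
  (∀ e ∈ S.edges, e.1 ∈ S.verts ∧ e.2 ∈ S.verts) ∧
  S.edges.image (fun e => (S.pos e.1, S.pos e.2)) = G.edges

/-- The elementary edit operations. -/
inductive EditOp (d : ℕ) where
  | delVert (i : ℕ)
  | insVert (i : ℕ) (p : Pt d)
  | delEdge (i j : ℕ)
  | insEdge (i j : ℕ)
  | moveVert (i : ℕ) (p : Pt d)

namespace EditOp

/-- The effect of an edit operation on a state. -/
def apply {d : ℕ} (S : EState d) : EditOp d → EState d
  | delVert i => ⟨S.verts.erase i, S.pos, S.edges⟩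
  | insVert i p => ⟨insert i S.verts, Function.update S.pos i p, S.edges⟩
  | delEdge i j => ⟨S.verts, S.pos, S.edges.erase (i, j)⟩
  | insEdge i j => ⟨S.verts, S.pos, insert (i, j) S.edges⟩
  | moveVert i p => ⟨S.verts, Function.update S.pos i p, S.edges⟩

/-- Legality of an edit operation on a state: only isolated existing vertices may be deleted,
inserted vertices are new, deleted edges exist, and inserted edges join existing vertices. -/
def legal {d : ℕ} (S : EState d) : EditOp d → Prop
  | delVert i => i ∈ S.verts ∧ ∀ e ∈ S.edges, e.1 ≠ i ∧ e.2 ≠ i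
  | insVert i _ => i ∉ S.verts
  | delEdge i j => (i, j) ∈ S.edges
  | insEdge i j => i ∈ S.verts ∧ j ∈ S.verts ∧ (i, j) ∉ S.edges
  | moveVert i _ => i ∈ S.verts

/-- The cost of an edit operation: vertex insertion/deletion is free, edge insertion/deletion
costs `C_E` times the edge length, and translating a vertex costs `C_V` times the displacement
plus `C_E` times the total change in length of all incident edges. -/
def cost {d : ℕ} (CV CE : ℝ) (S : EState d) : EditOp d → ℝ
  | delVert _ => 0
  | insVert _ _ => 0
  | delEdge i j => CE * dist (S.pos i) (S.pos j)
  | insEdge i j => CE * dist (S.pos i) (S.pos j)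
  | moveVert i p => CV * dist (S.pos i) p +
      ∑ e ∈ S.edges,
        CE * |dist (Function.update S.pos i p e.1) (Function.update S.pos i p e.2)
                - dist (S.pos e.1) (S.pos e.2)|

/-- The inverse of an edit operation (relative to the state it is applied to). -/
def inv {d : ℕ} (S : EState d) : EditOp d → EditOp d
  | delVert i => insVert i (S.pos i)
  | insVert i _ => delVert i
  | delEdge i j => insEdge i j
  | insEdge i j => delEdge i j
  | moveVert i _ => moveVert i (S.pos i)

end EditOp

/-- Applying a sequence of edit operations. -/
def applyPath {d : ℕ} (S : EState d) (P : List (EditOp d)) : EState d :=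
  P.foldl EditOp.apply S

/-- Every operation of the sequence is legal on the intermediate result it is applied to. -/
def legalPath {d : ℕ} : EState d → List (EditOp d) → Prop
  | _, [] => True
  | S, o :: P => EditOp.legal S o ∧ legalPath (EditOp.apply S o) P

/-- The cost of an edit path: the sum of the costs of its individual edits. -/
def pathCost {d : ℕ} (CV CE : ℝ) : EState d → List (EditOp d) → ℝ
  | _, [] => 0
  | S, o :: P => EditOp.cost CV CE S o + pathCost CV CE (EditOp.apply S o) P

/-- The inverse edit path: the reversed sequence of the inverse operations. -/
def invPath {d : ℕ} : EState d → List (EditOp d) → List (EditOp d)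
  | _, [] => []
  | S, o :: P => invPath (EditOp.apply S o) P ++ [EditOp.inv S o]

/-- `P` is an edit path from `G` to `H`, starting at the representing state `S`. -/
def IsEditPathFrom {d : ℕ} (G H : EGraph d) (S : EState d) (P : List (EditOp d)) : Prop :=
  S.Represents G ∧ legalPath S P ∧ (applyPath S P).Represents H

/-- The geometric edit distance: the infimum cost of an edit path from `G` to `H`. -/
def GED {d : ℕ} (CV CE : ℝ) (G H : GeoGraph d) : ℝ :=
  sInf {c : ℝ | ∃ (S : EState d) (P : List (EditOp d)),
    IsEditPathFrom G.toEGraph H.toEGraph S P ∧ pathCost CV CE S P = c}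

/-- Distance between possibly-dummy vertices: `|a − ε_V| = 0`. -/
def odist {d : ℕ} : Option (Pt d) → Option (Pt d) → ℝ
  | some a, some b => dist a b
  | _, _ => 0

/-- Length of a possibly-dummy edge: `|ε_E| = 0`. -/
def elen {d : ℕ} : Option (Pt d × Pt d) → ℝ
  | some e => dist e.1 e.2
  | none => 0

/-- One step of the evolution of the vertex with label `i` under an edit operation;
a deleted vertex is recorded as the dummy vertex `none` and stays dummy. -/
def vStep {d : ℕ} (i : ℕ) (o : EditOp d) (s : Option (Pt d)) : Option (Pt d) :=
  match s, o with
  | none, _ => none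
  | some _, .delVert j => if j = i then none else s
  | some _, .moveVert j p => if j = i then some p else s
  | some _, _ => s

/-- The end result `P(u)` of the evolution of the vertex with label `i` under the path `P`. -/
def vTrack {d : ℕ} (i : ℕ) (P : List (EditOp d)) (s : Option (Pt d)) : Option (Pt d) :=
  P.foldl (fun s o => vStep i o s) s

/-- The cost of the orbit of the vertex with label `i`:
`C_V` times the total displacement along the orbit. -/
def vOrbitCost {d : ℕ} (CV : ℝ) (i : ℕ) : Option (Pt d) → List (EditOp d) → ℝ
  | _, [] => 0
  | s, o :: P => CV * odist s (vStep i o s) + vOrbitCost CV i (vStep i o s) P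

/-- One step of the evolution of the edge with label pair `(i, j)` under an edit operation;
a deleted edge (or an edge losing an endpoint) is recorded as the dummy edge `none`. -/
def eStep {d : ℕ} (i j : ℕ) (o : EditOp d) (s : Option (Pt d × Pt d)) :
    Option (Pt d × Pt d) :=
  match s, o with
  | none, _ => none
  | some _, .delEdge a b => if a = i ∧ b = j then none else s
  | some _, .delVert a => if a = i ∨ a = j then none else s
  | some q, .moveVert a p =>
      if a = i then some (p, q.2) else if a = j then some (q.1, p) else s
  | some _, _ => s

/-- The end result `P(e)` of the evolution of the edge with label pair `(i, j)` under `P`. -/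
def eTrack {d : ℕ} (i j : ℕ) (P : List (EditOp d)) (s : Option (Pt d × Pt d)) :
    Option (Pt d × Pt d) :=
  P.foldl (fun s o => eStep i j o s) s

/-- The cost of the orbit of the edge with label pair `(i, j)`:
`C_E` times the total variation of its length along the orbit. -/
def eOrbitCost {d : ℕ} (CE : ℝ) (i j : ℕ) : Option (Pt d × Pt d) → List (EditOp d) → ℝ
  | _, [] => 0
  | s, o :: P => CE * |elen (eStep i j o s) - elen s| + eOrbitCost CE i j (eStep i j o s) P

/-- An inexact matching between `G` and `H`: every vertex of `G` is matched with exactly one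
vertex of `H` or with the dummy vertex (`none`), and conversely, consistently. -/
structure Matching (d : ℕ) (G H : EGraph d) where
  f : Pt d → Option (Pt d)
  g : Pt d → Option (Pt d)
  f_mem : ∀ u ∈ G.verts, ∀ v, f u = some v → v ∈ H.verts
  g_mem : ∀ v ∈ H.verts, ∀ u, g v = some u → u ∈ G.verts
  consistent : ∀ u ∈ G.verts, ∀ v ∈ H.verts, (f u = some v ↔ g v = some u)

/-- The image `π(e) = (π(u₁), π(u₂))` of an edge under a matching: it is the dummy edge `none`
if either endpoint is matched with the dummy vertex, or if the image is not an edge of the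
target graph `T`. -/
def mEdge {d : ℕ} (T : EGraph d) (φ : Pt d → Option (Pt d)) (e : Pt d × Pt d) :
    Option (Pt d × Pt d) :=
  match φ e.1, φ e.2 with
  | some a, some b => if (a, b) ∈ T.edges then some (a, b) else none
  | _, _ => none

/-- The cost of an inexact matching: vertex translations, edge translations, and deletions of
the unmatched edges from both graphs. -/
def matchCost {d : ℕ} (CV CE : ℝ) {G H : EGraph d} (m : Matching d G H) : ℝ :=
  (∑ u ∈ G.verts.filter (fun u => m.f u ≠ none), CV * odist (some u) (m.f u)) +
  (∑ e ∈ G.edges.filter (fun e => mEdge H m.f e ≠ none),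
      CE * |dist e.1 e.2 - elen (mEdge H m.f e)|) +
  (∑ e ∈ G.edges.filter (fun e => mEdge H m.f e = none), CE * dist e.1 e.2) +
  (∑ f ∈ H.edges.filter (fun f => mEdge G m.g f = none), CE * dist f.1 f.2)

/-- The geometric graph distance: the minimum cost of an inexact matching. -/
def GGD {d : ℕ} (CV CE : ℝ) (G H : GeoGraph d) : ℝ :=
  sInf {c : ℝ | ∃ m : Matching d G.toEGraph H.toEGraph, matchCost CV CE m = c}

/-- The point `(a, b)` of `ℝ²`. -/
def pt2 (a b : ℝ) : Pt 2 := (WithLp.equiv 2 (Fin 2 → ℝ)).symm ![a, b]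

/-- The point `a` of `ℝ¹`. -/
def pt1 (a : ℝ) : Pt 1 := (WithLp.equiv 2 (Fin 1 → ℝ)).symm ![a]


/-! ### Helper lemmas -/

/-- Every edge of the state joins existing vertices. -/
def EState.Wf (S : EState 2) : Prop := ∀ e ∈ S.edges, e.1 ∈ S.verts ∧ e.2 ∈ S.verts

/-- Length of the edge with label `e`, zero if it is absent. -/
def EState.len (S : EState 2) (e : ℕ × ℕ) : ℝ :=
  if e ∈ S.edges then dist (S.pos e.1) (S.pos e.2) else 0

lemma pt2_zero (a b : ℝ) : pt2 a b 0 = a := by simp [pt2]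
lemma pt2_one (a b : ℝ) : pt2 a b 1 = b := by simp [pt2]

lemma dist_pt (p q : Pt 2) : dist p q = Real.sqrt ((p 0 - q 0) ^ 2 + (p 1 - q 1) ^ 2) := by
  rw [EuclideanSpace.dist_eq, Fin.sum_univ_two]
  simp [Real.dist_eq, sq_abs]

lemma dist_pt_sq (p q : Pt 2) : dist p q ^ 2 = (p 0 - q 0) ^ 2 + (p 1 - q 1) ^ 2 := by
  rw [dist_pt, Real.sq_sqrt (by positivity)]

lemma le_dist_pt (p q : Pt 2) : q 1 - p 1 ≤ dist p q := by
  rw [dist_pt]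
  apply Real.le_sqrt_of_sq_le
  nlinarith [sq_nonneg (p 0 - q 0)]

lemma wf_apply {S : EState 2} (h : S.Wf) {o : EditOp 2} (ho : o.legal S) :
    (EditOp.apply S o).Wf := by
  intro e he
  cases o with
  | delVert i =>
    simp only [EditOp.apply, EditOp.legal] at *
    have := h e he
    have h2 := ho.2 e he
    simp [this, h2]
  | insVert i p =>
    simp only [EditOp.apply, EditOp.legal] at *
    have := h e he
    simp [this]
  | delEdge i j =>
    simp only [EditOp.apply] at *
    exact h e (Finset.mem_of_mem_erase he)
  | insEdge i j =>
    simp only [EditOp.apply, EditOp.legal] at *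
    rcases Finset.mem_insert.1 he with rfl | he
    · exact ⟨ho.1, ho.2.1⟩
    · exact h e he
  | moveVert i p =>
    simp only [EditOp.apply] at *
    exact h e he

lemma cost_nonneg {CV CE : ℝ} (hCV : 0 < CV) (hCE : 0 < CE) (S : EState 2) (o : EditOp 2) :
    0 ≤ o.cost CV CE S := by
  cases o <;> simp only [EditOp.cost] <;> positivity

lemma len_nonneg (S : EState 2) (e : ℕ × ℕ) : 0 ≤ S.len e := by
  unfold EState.len; split_ifs <;> positivity

lemma insVert_pos {S : EState 2} (h : S.Wf) {i : ℕ} (p : Pt 2) (hi : i ∉ S.verts)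
    {e : ℕ × ℕ} (he : e ∈ S.edges) :
    Function.update S.pos i p e.1 = S.pos e.1 ∧ Function.update S.pos i p e.2 = S.pos e.2 := by
  have := h e he
  constructor <;> apply Function.update_of_ne <;> rintro rfl
  · exact hi this.1
  · exact hi this.2

/-- Edge part of the cost of one operation. -/
lemma step_len {CV CE : ℝ} (hCV : 0 < CV) (hCE : 0 < CE) {S : EState 2} (h : S.Wf)
    {o : EditOp 2} (ho : o.legal S) (T : Finset (ℕ × ℕ)) :
    CE * ∑ e ∈ T, |(EditOp.apply S o).len e - S.len e| ≤ o.cost CV CE S := by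
  cases o with
  | delVert i =>
    have : ∀ e, (EditOp.apply S (.delVert i)).len e = S.len e := fun e => rfl
    simp [this, EditOp.cost]
  | insVert i p =>
    simp only [EditOp.cost]
    rw [Finset.sum_eq_zero, mul_zero]
    intro e _
    simp only [EditOp.apply, EState.len]
    by_cases he : e ∈ S.edges
    · rw [(insVert_pos h p ho he).1, (insVert_pos h p ho he).2]; simp [he]
    · simp [he]
  | delEdge i j =>
    simp only [EditOp.cost]
    apply mul_le_mul_of_nonneg_left _ hCE.le
    calc ∑ e ∈ T, |(EditOp.apply S (.delEdge i j)).len e - S.len e|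
        ≤ ∑ e ∈ T, if e = (i, j) then dist (S.pos i) (S.pos j) else 0 := by
          apply Finset.sum_le_sum
          intro e _
          simp only [EditOp.apply, EState.len, Finset.mem_erase]
          by_cases hee : e = (i, j)
          · subst hee
            split_ifs <;> simp_all
          · simp [hee]
      _ ≤ _ := by
          rw [Finset.sum_ite_eq']
          split_ifs <;> first | exact le_rfl | exact dist_nonneg
  | insEdge i j =>
    simp only [EditOp.cost]
    apply mul_le_mul_of_nonneg_left _ hCE.le
    calc ∑ e ∈ T, |(EditOp.apply S (.insEdge i j)).len e - S.len e|
        ≤ ∑ e ∈ T, if e = (i, j) then dist (S.pos i) (S.pos j) else 0 := by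
          apply Finset.sum_le_sum
          intro e _
          simp only [EditOp.apply, EState.len, Finset.mem_insert]
          by_cases hee : e = (i, j)
          · subst hee
            have := ho.2.2
            simp [this]
          · simp [hee]
      _ ≤ _ := by
          rw [Finset.sum_ite_eq']
          split_ifs <;> first | exact le_rfl | exact dist_nonneg
  | moveVert i p =>
    simp only [EditOp.cost]
    rw [Finset.mul_sum]
    have h1 : ∑ e ∈ T, CE * |(EditOp.apply S (.moveVert i p)).len e - S.len e|
        = ∑ e ∈ T ∩ S.edges, CE * |(EditOp.apply S (.moveVert i p)).len e - S.len e| := by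
      symm
      apply Finset.sum_subset Finset.inter_subset_left
      intro e he hne
      have : e ∉ S.edges := fun hh => hne (Finset.mem_inter.2 ⟨he, hh⟩)
      simp [EditOp.apply, EState.len, this]
    have h2 : ∑ e ∈ T ∩ S.edges, CE * |(EditOp.apply S (.moveVert i p)).len e - S.len e|
        ≤ ∑ e ∈ S.edges, CE * |(EditOp.apply S (.moveVert i p)).len e - S.len e| := by
      apply Finset.sum_le_sum_of_subset_of_nonneg Finset.inter_subset_right
      intros; positivity
    have h3 : ∑ e ∈ S.edges, CE * |(EditOp.apply S (.moveVert i p)).len e - S.len e|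
        = ∑ e ∈ S.edges,
        CE * |dist (Function.update S.pos i p e.1) (Function.update S.pos i p e.2)
                - dist (S.pos e.1) (S.pos e.2)| := by
      apply Finset.sum_congr rfl
      intro e he
      simp [EditOp.apply, EState.len, he]
    have h4 : 0 ≤ CV * dist (S.pos i) p := by positivity
    linarith

lemma step_len_one {CV CE : ℝ} (hCV : 0 < CV) (hCE : 0 < CE) {S : EState 2} (h : S.Wf)
    {o : EditOp 2} (ho : o.legal S) (e : ℕ × ℕ) :
    CE * |(EditOp.apply S o).len e - S.len e| ≤ o.cost CV CE S := by
  simpa using step_len hCV hCE h ho {e}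

lemma path_len {CV CE : ℝ} (hCV : 0 < CV) (hCE : 0 < CE) (T : Finset (ℕ × ℕ))
    (P : List (EditOp 2)) : ∀ {S : EState 2}, S.Wf → legalPath S P →
    CE * ∑ e ∈ T, |(applyPath S P).len e - S.len e| ≤ pathCost CV CE S P := by
  induction P with
  | nil => intro S _ _; simp [applyPath, pathCost]
  | cons o P ih =>
    intro S h hl
    have h1 := ih (wf_apply h hl.1) hl.2
    have h2 := step_len hCV hCE h hl.1 T
    have h3 : ∑ e ∈ T, |(applyPath S (o :: P)).len e - S.len e| ≤
        ∑ e ∈ T, |(applyPath (EditOp.apply S o) P).len e - (EditOp.apply S o).len e| +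
        ∑ e ∈ T, |(EditOp.apply S o).len e - S.len e| := by
      rw [← Finset.sum_add_distrib]
      exact Finset.sum_le_sum fun e _ => abs_sub_le _ _ _
    have h4 := mul_le_mul_of_nonneg_left h3 hCE.le
    rw [mul_add] at h4
    simp only [pathCost]
    linarith

lemma path_len_one {CV CE : ℝ} (hCV : 0 < CV) (hCE : 0 < CE) (e : ℕ × ℕ)
    (P : List (EditOp 2)) {S : EState 2} (h : S.Wf) (hl : legalPath S P) :
    CE * |(applyPath S P).len e - S.len e| ≤ pathCost CV CE S P := by
  simpa using path_len hCV hCE {e} P h hl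

/-- If an isolated-move cost equals its vertical part and the edge keeps its length,
the vertex does not move. -/
lemma move_rigid {CV CE : ℝ} (hCV : 0 < CV) (hCE : 0 < CE) (p q r : Pt 2) (hy : p 1 = r 1)
    (c : ℝ) (hc : CV * dist p q + CE * |dist q r - dist p r| ≤ c) :
    CV * (q 1 - p 1) < c ∨ q = p := by
  by_contra hcon
  push Not at hcon
  obtain ⟨h1, h2⟩ := hcon
  apply h2
  have h3 := le_dist_pt p q
  have h4 : 0 ≤ |dist q r - dist p r| := abs_nonneg _
  have h5 := mul_nonneg hCE.le h4
  have h6 := mul_le_mul_of_nonneg_left h3 hCV.le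
  have h7 : dist p q = q 1 - p 1 := by
    have : CV * dist p q = CV * (q 1 - p 1) := by linarith
    exact mul_left_cancel₀ hCV.ne' this
  have h8 : |dist q r - dist p r| = 0 := by
    have : CE * |dist q r - dist p r| = 0 := by linarith
    rcases mul_eq_zero.1 this with h | h
    · exact absurd h hCE.ne'
    · exact h
  have h9 : dist q r = dist p r := by linarith [abs_eq_zero.1 h8]
  have ha := dist_pt_sq p q
  have hb := dist_pt_sq q r
  have hd := dist_pt_sq p r
  rw [h7] at ha
  have hx : (p 0 - q 0) ^ 2 = 0 := by nlinarith
  have hx' : p 0 = q 0 := by linarith [pow_eq_zero_iff (two_ne_zero) |>.1 hx]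
  rw [h9, hd, hx', hy] at hb
  have hyy : (q 1 - r 1) ^ 2 = 0 := by nlinarith
  have hy' : q 1 = r 1 := by linarith [pow_eq_zero_iff (two_ne_zero) |>.1 hyy]
  ext k
  fin_cases k
  · exact hx'.symm
  · simp; linarith

/-- One operation that keeps the edge `(a, b)`. -/
lemma step_keep {CV CE : ℝ} (hCV : 0 < CV) (hCE : 0 < CE) {S : EState 2} (h : S.Wf)
    {o : EditOp 2} (ho : o.legal S) {a b : ℕ} (hab : a ≠ b) (he : (a, b) ∈ S.edges) :
    CV * (((EditOp.apply S o).pos a 1 - S.pos a 1) + ((EditOp.apply S o).pos b 1 - S.pos b 1))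
      ≤ o.cost CV CE S ∧
    (S.pos a 1 = S.pos b 1 →
      CV * (((EditOp.apply S o).pos a 1 - S.pos a 1) + ((EditOp.apply S o).pos b 1 - S.pos b 1))
        < o.cost CV CE S ∨
      ((EditOp.apply S o).pos a = S.pos a ∧ (EditOp.apply S o).pos b = S.pos b)) := by
  have hn := cost_nonneg hCV hCE S o
  cases o with
  | delVert i => exact ⟨by simpa [EditOp.apply] using hn, fun _ => Or.inr ⟨rfl, rfl⟩⟩
  | insVert i p =>
    have h1 := insVert_pos h p ho he
    simp only [EditOp.apply] at *
    rw [h1.1, h1.2]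
    exact ⟨by simpa using hn, fun _ => Or.inr ⟨rfl, rfl⟩⟩
  | delEdge i j => exact ⟨by simpa [EditOp.apply] using hn, fun _ => Or.inr ⟨rfl, rfl⟩⟩
  | insEdge i j => exact ⟨by simpa [EditOp.apply] using hn, fun _ => Or.inr ⟨rfl, rfl⟩⟩
  | moveVert i p =>
    have hs : CV * dist (S.pos i) p +
        CE * |dist (Function.update S.pos i p a) (Function.update S.pos i p b)
                - dist (S.pos a) (S.pos b)| ≤ EditOp.cost CV CE S (.moveVert i p) := by
      simp only [EditOp.cost]
      have := Finset.single_le_sum (f := fun e : ℕ × ℕ =>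
        CE * |dist (Function.update S.pos i p e.1) (Function.update S.pos i p e.2)
                - dist (S.pos e.1) (S.pos e.2)|) (fun _ _ => by positivity) he
      simp only at this
      linarith
    have hd := mul_le_mul_of_nonneg_left (le_dist_pt (S.pos i) p) hCV.le
    have hz : 0 ≤ CE * |dist (Function.update S.pos i p a) (Function.update S.pos i p b)
                - dist (S.pos a) (S.pos b)| := by positivity
    simp only [EditOp.apply]
    by_cases hia : i = a
    · subst hia
      rw [Function.update_of_ne hab.symm] at hs hz ⊢
      rw [Function.update_self] at hs hz ⊢
      refine ⟨by linarith, fun hy => ?_⟩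
      rcases move_rigid hCV hCE _ _ _ hy _ hs with h1 | h1
      · left; simpa using h1
      · right; exact ⟨h1, rfl⟩
    · by_cases hib : i = b
      · subst hib
        rw [Function.update_of_ne hab] at hs hz ⊢
        rw [Function.update_self] at hs hz ⊢
        refine ⟨by linarith, fun hy => ?_⟩
        rw [dist_comm (S.pos a) p, dist_comm (S.pos a) (S.pos i)] at hs
        rcases move_rigid hCV hCE _ _ _ hy.symm _ hs with h1 | h1
        · left; simpa using h1
        · right; exact ⟨rfl, h1⟩
      · rw [Function.update_of_ne (Ne.symm hia), Function.update_of_ne (Ne.symm hib)]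
        exact ⟨by simpa using hn, fun _ => Or.inr ⟨rfl, rfl⟩⟩

lemma path_keep {CV CE : ℝ} (hCV : 0 < CV) (hCE : 0 < CE) {a b : ℕ} (hab : a ≠ b)
    (P : List (EditOp 2)) : ∀ {S : EState 2}, S.Wf → legalPath S P → (a, b) ∈ S.edges →
    CE * (S.len (a, b) + (applyPath S P).len (a, b)) ≤ pathCost CV CE S P ∨
    (CV * (((applyPath S P).pos a 1 - S.pos a 1) + ((applyPath S P).pos b 1 - S.pos b 1))
      ≤ pathCost CV CE S P ∧
    (S.pos a 1 = S.pos b 1 →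
      CV * (((applyPath S P).pos a 1 - S.pos a 1) + ((applyPath S P).pos b 1 - S.pos b 1))
        < pathCost CV CE S P ∨
      ((applyPath S P).pos a = S.pos a ∧ (applyPath S P).pos b = S.pos b))) := by
  induction P with
  | nil => intro S _ _ _; right; simp [applyPath, pathCost]
  | cons o P ih =>
    intro S h hl he
    have hw := wf_apply h hl.1
    have hE : applyPath S (o :: P) = applyPath (EditOp.apply S o) P := rfl
    rw [hE]
    simp only [pathCost]
    have h1 := step_len_one hCV hCE h hl.1 (a, b)
    by_cases hk : (a, b) ∈ (EditOp.apply S o).edges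
    · rcases ih hw hl.2 hk with h2 | ⟨h2, h3⟩
      · left
        have h4 := neg_abs_le ((EditOp.apply S o).len (a, b) - S.len (a, b))
        have h5 : CE * S.len (a, b) ≤ CE * ((EditOp.apply S o).len (a, b) +
          |(EditOp.apply S o).len (a, b) - S.len (a, b)|) :=
          mul_le_mul_of_nonneg_left (by linarith) hCE.le
        linarith
      · right
        obtain ⟨h4, h5⟩ := step_keep hCV hCE h hl.1 hab he
        refine ⟨by linarith, fun hy => ?_⟩
        rcases h5 hy with h6 | ⟨h6, h7⟩
        · left; linarith
        · rw [h6, h7] at h3 h4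
          rcases h3 hy with h8 | h8
          · left; linarith
          · right; exact h8
    · left
      have h2 := path_len_one hCV hCE (a, b) P hw hl.2
      have h0 : (EditOp.apply S o).len (a, b) = 0 := by simp [EState.len, hk]
      rw [h0, zero_sub, abs_neg, abs_of_nonneg (len_nonneg _ _)] at h1
      rw [h0, sub_zero, abs_of_nonneg (len_nonneg _ _)] at h2
      linarith

lemma represents_single {S : EState 2} {G : EGraph 2} {p q : Pt 2} (hS : S.Represents G)
    (hG : G.edges = {(p, q)}) :
    ∃ e ∈ S.edges, S.pos e.1 = p ∧ S.pos e.2 = q ∧ ∀ f ∈ S.edges, f = e := by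
  obtain ⟨hi, -, hw, him⟩ := hS
  rw [hG] at him
  have : (p, q) ∈ S.edges.image (fun e => (S.pos e.1, S.pos e.2)) := by rw [him]; simp
  obtain ⟨e, he, hpe⟩ := Finset.mem_image.1 this
  have hpe' := Prod.mk.injEq _ _ _ _ ▸ hpe
  refine ⟨e, he, hpe'.1, hpe'.2, fun f hf => ?_⟩
  have hf' := Finset.mem_image_of_mem (fun e => (S.pos e.1, S.pos e.2)) hf
  rw [him, Finset.mem_singleton] at hf'
  have hf'' := Prod.mk.injEq _ _ _ _ ▸ hf'
  ext1
  · exact hi (hw f hf).1 (hw e he).1 (hf''.1.trans hpe'.1.symm)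
  · exact hi (hw f hf).2 (hw e he).2 (hf''.2.trans hpe'.2.symm)

lemma lower_bound {CV CE : ℝ} (hCV : 0 < CV) (hCE : 0 < CE) (hlt : CV < CE) {G H : EGraph 2}
    (hGe : G.edges = {(pt2 0 0, pt2 1 0)}) (hHe : H.edges = {(pt2 0 1, pt2 1 1)})
    {S : EState 2} {P : List (EditOp 2)} (hP : IsEditPathFrom G H S P) :
    2 * CV < pathCost CV CE S P := by
  obtain ⟨hS, hl, hR⟩ := hP
  have hw : S.Wf := hS.2.2.1
  obtain ⟨⟨a, b⟩, he, ha, hb, hu⟩ := represents_single hS hGe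
  obtain ⟨f, hf, hc, hd, hu'⟩ := represents_single hR hHe
  simp only at ha hb
  have hab : a ≠ b := by
    rintro rfl
    have := congrArg (fun p : Pt 2 => p 0) (ha.symm.trans hb)
    simp [pt2_zero] at this
  have hl1 : S.len (a, b) = 1 := by
    simp [EState.len, he, ha, hb, dist_pt, pt2_zero, pt2_one]
  have hl2 : (applyPath S P).len f = 1 := by
    simp [EState.len, hf, hc, hd, dist_pt, pt2_zero, pt2_one]
  by_cases hfe : f = (a, b)
  · subst hfe
    simp only at hc hd
    rcases path_keep hCV hCE hab P hw hl he with h1 | ⟨-, h1⟩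
    · rw [hl1, hl2] at h1; linarith
    · rw [ha, hb, hc, hd] at h1
      simp only [pt2_one] at h1
      rcases h1 trivial with h2 | ⟨h2, -⟩
      · linarith
      · have := congrArg (fun p : Pt 2 => p 1) h2
        simp [pt2_one] at this
  · have h1 := path_len hCV hCE {f, (a, b)} P hw hl
    have hl3 : S.len f = 0 := by
      have : f ∉ S.edges := fun hh => hfe (hu f hh)
      simp [EState.len, this]
    have hl4 : (applyPath S P).len (a, b) = 0 := by
      have : (a, b) ∉ (applyPath S P).edges := fun hh => hfe (hu' _ hh).symm
      simp [EState.len, this]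
    rw [Finset.sum_pair hfe, hl1, hl2, hl3, hl4] at h1
    norm_num at h1
    linarith

/-! ### The zigzag paths -/

/-- Vertex positions of the zigzag states. -/
def zpos (s t : ℝ) : ℕ → Pt 2 := fun k => if k = 0 then pt2 0 s else if k = 1 then pt2 1 t else 0

/-- The zigzag states. -/
def zst (s t : ℝ) : EState 2 := ⟨{0, 1}, zpos s t, {(0, 1)}⟩

/-- The zigzag edit path. -/
def zig (h : ℝ) : ℝ → ℕ → List (EditOp 2)
  | _, 0 => []
  | t, n + 1 => .moveVert 0 (pt2 0 (t + h)) :: .moveVert 1 (pt2 1 (t + h)) :: zig h (t + h) n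

lemma zst_move0 (s t s' : ℝ) : EditOp.apply (zst s t) (.moveVert 0 (pt2 0 s')) = zst s' t := by
  simp only [EditOp.apply, zst, EState.mk.injEq, true_and, and_true]
  funext k
  by_cases hk : k = 0 <;> simp [zpos, hk, Function.update_apply]

lemma zst_move1 (s t t' : ℝ) : EditOp.apply (zst s t) (.moveVert 1 (pt2 1 t')) = zst s t' := by
  simp only [EditOp.apply, zst, EState.mk.injEq, true_and, and_true]
  funext k
  by_cases hk : k = 1 <;> simp [zpos, hk, Function.update_apply]

lemma zig_legal (h : ℝ) (n : ℕ) : ∀ t, legalPath (zst t t) (zig h t n) := by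
  induction n with
  | zero => intro t; trivial
  | succ n ih =>
    intro t
    simp only [zig, legalPath, zst_move0, zst_move1]
    refine ⟨by simp [EditOp.legal, zst], by simp [EditOp.legal, zst], ih _⟩

lemma zig_apply (h : ℝ) (n : ℕ) : ∀ t, applyPath (zst t t) (zig h t n) =
    zst (t + n * h) (t + n * h) := by
  induction n with
  | zero => intro t; simp [applyPath, zig]
  | succ n ih =>
    intro t
    have := ih (t + h)
    simp only [applyPath, zig, List.foldl_cons, zst_move0, zst_move1] at this ⊢
    rw [this]
    push_cast
    congr 1 <;> ring

lemma sqrt_bound (h : ℝ) : |Real.sqrt (1 + h ^ 2) - 1| ≤ h ^ 2 / 2 := by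
  have h1 : 1 ≤ Real.sqrt (1 + h ^ 2) := Real.one_le_sqrt.2 (by nlinarith [sq_nonneg h])
  have h2 := Real.sq_sqrt (show 0 ≤ 1 + h ^ 2 by positivity)
  rw [abs_of_nonneg (by linarith)]
  nlinarith [sq_nonneg (Real.sqrt (1 + h ^ 2) - 1)]

lemma zig_cost {CV CE : ℝ} (hCE : 0 < CE) (h : ℝ) (hh : 0 ≤ h) (n : ℕ) :
    ∀ t, pathCost CV CE (zst t t) (zig h t n) ≤ n * (2 * CV * h + CE * h ^ 2) := by
  induction n with
  | zero => intro t; simp [pathCost, zig]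
  | succ n ih =>
    intro t
    have h1 := ih (t + h)
    have hb := mul_le_mul_of_nonneg_left (sqrt_bound h) hCE.le
    have c0 : EditOp.cost CV CE (zst t t) (.moveVert 0 (pt2 0 (t + h))) =
        CV * h + CE * |Real.sqrt (1 + h ^ 2) - 1| := by
      simp [EditOp.cost, zst, zpos, dist_pt, pt2_zero, pt2_one, Real.sqrt_sq_eq_abs,
        abs_of_nonneg hh]
    have c1 : EditOp.cost CV CE (zst (t + h) t) (.moveVert 1 (pt2 1 (t + h))) =
        CV * h + CE * |Real.sqrt (1 + h ^ 2) - 1| := by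
      simp [EditOp.cost, zst, zpos, dist_pt, pt2_zero, pt2_one, Real.sqrt_sq_eq_abs,
        abs_of_nonneg hh, abs_sub_comm]
    simp only [zig, pathCost, zst_move0, zst_move1, c0, c1]
    push_cast
    linarith

lemma zst_represents {G : EGraph 2} (t : ℝ) (hv : G.verts = {pt2 0 t, pt2 1 t})
    (he : G.edges = {(pt2 0 t, pt2 1 t)}) : (zst t t).Represents G := by
  have hne : pt2 0 t ≠ pt2 1 t := by
    intro h
    have := congrArg (fun p : Pt 2 => p 0) h
    simp [pt2_zero] at this
  refine ⟨?_, ?_, ?_, ?_⟩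
  · intro i hi j hj hij
    simp [zst] at hi hj
    rcases hi with rfl | rfl <;> rcases hj with rfl | rfl
    · rfl
    · exact absurd (by simpa [zst, zpos] using hij) hne
    · exact absurd (by simpa [zst, zpos] using hij.symm) hne
    · rfl
  · rw [hv]
    simp [zst, zpos, Finset.image_insert]
  · simp [zst]
  · rw [he]
    simp [zst, zpos]

/-- For `G` the single-edge geometric graph on the vertices `(0,0)`, `(1,0)` and
`H` the single-edge geometric graph on the vertices `(0,1)`, `(1,1)`, if `C_E > C_V` then
`GED(G,H) = 2·C_V`, and no edit path from `G` to `H` attains cost `2·C_V`: the infimum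
defining `GED(G,H)` is not achieved. -/
theorem ged_infimum_not_attained (CV CE : ℝ) (hCV : 0 < CV) (hCE : 0 < CE) (hlt : CV < CE)
    (G H : GeoGraph 2)
    (hGv : G.verts = {pt2 0 0, pt2 1 0}) (hGe : G.edges = {(pt2 0 0, pt2 1 0)})
    (hHv : H.verts = {pt2 0 1, pt2 1 1}) (hHe : H.edges = {(pt2 0 1, pt2 1 1)}) :
    GED CV CE G H = 2 * CV ∧
    ¬ ∃ (S : EState 2) (P : List (EditOp 2)),
        IsEditPathFrom G.toEGraph H.toEGraph S P ∧ pathCost CV CE S P = 2 * CV := by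
  have hlow : ∀ c ∈ {c : ℝ | ∃ (S : EState 2) (P : List (EditOp 2)),
      IsEditPathFrom G.toEGraph H.toEGraph S P ∧ pathCost CV CE S P = c}, 2 * CV < c := by
    rintro c ⟨S, P, hP, rfl⟩
    exact lower_bound hCV hCE hlt hGe hHe hP
  have hup : ∀ n : ℕ, IsEditPathFrom G.toEGraph H.toEGraph (zst 0 0)
      (zig (1 / ((n : ℝ) + 1)) 0 (n + 1)) := by
    intro n
    refine ⟨zst_represents 0 hGv hGe, zig_legal _ _ _, ?_⟩
    rw [zig_apply]
    have h1 : (0 : ℝ) + ((n + 1 : ℕ) : ℝ) * (1 / ((n : ℝ) + 1)) = 1 := by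
      push_cast
      have : (n : ℝ) + 1 ≠ 0 := by positivity
      field_simp
      ring
    rw [h1]
    exact zst_represents 1 hHv hHe
  refine ⟨?_, ?_⟩
  · apply le_antisymm
    · apply le_of_forall_pos_le_add
      intro ε hε
      obtain ⟨n, hn⟩ := exists_nat_gt (CE / ε)
      have hle : GED CV CE G H ≤
          pathCost CV CE (zst 0 0) (zig (1 / ((n : ℝ) + 1)) 0 (n + 1)) :=
        csInf_le ⟨2 * CV, fun c hc => (hlow c hc).le⟩ ⟨_, _, hup n, rfl⟩
      have hc := zig_cost (CV := CV) hCE (1 / ((n : ℝ) + 1)) (by positivity) (n + 1) 0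
      have hn1 : (0 : ℝ) < (n : ℝ) + 1 := by positivity
      have h2 : ((n + 1 : ℕ) : ℝ) * (2 * CV * (1 / ((n : ℝ) + 1)) + CE * (1 / ((n : ℝ) + 1)) ^ 2)
          = 2 * CV + CE / ((n : ℝ) + 1) := by
        push_cast
        field_simp
      have h3 : CE / ((n : ℝ) + 1) ≤ ε := by
        rw [div_le_iff₀ hn1]
        rw [div_lt_iff₀ hε] at hn
        nlinarith
      linarith
    · exact le_csInf ⟨_, _, _, hup 0, rfl⟩ fun c hc => (hlow c hc).le
  · rintro ⟨S, P, hP, hc⟩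
    exact absurd (hlow _ ⟨S, P, hP, hc⟩) (lt_irrefl _)
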